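/- For C ∈ ℝ\{1} and τ in the upper half-plane, with τ' = 1/(1−τ) and C' = 1/(1−C), one has f_{C'}(τ') = ((1−τ)⁷/(1−C))·f_C(τ), where f_C(τ) := (C−τ)g₂(τ)² − 18(Cη₁(τ) − η₂(τ))g₃(τ). -/

import Mathlib

open Complex Filter Asymptotics Set

noncomputable section

/-- q = e^{2πiτ} -/
def qq (τ : ℂ) : ℂ := Complex.exp (2 * (Real.pi : ℂ) * Complex.I * τ)

/-- divisor power sum σ_k(n) as a complex number -/
def sigmaC (k n : ℕ) : ℂ := ∑ d ∈ n.divisors, (d : ℂ) ^ k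

/-- normalized Eisenstein series E₂ -/
def E2 (τ : ℂ) : ℂ := 1 - 24 * ∑' n : ℕ, sigmaC 1 (n + 1) * qq τ ^ (n + 1)

/-- normalized Eisenstein series E₄ -/
def E4 (τ : ℂ) : ℂ := 1 + 240 * ∑' n : ℕ, sigmaC 3 (n + 1) * qq τ ^ (n + 1)

/-- normalized Eisenstein series E₆ -/
def E6 (τ : ℂ) : ℂ := 1 - 504 * ∑' n : ℕ, sigmaC 5 (n + 1) * qq τ ^ (n + 1)

/-- elliptic invariant g₂ -/
def g2 (τ : ℂ) : ℂ := (4 * (Real.pi : ℂ) ^ 4 / 3) * E4 τ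

/-- elliptic invariant g₃ -/
def g3 (τ : ℂ) : ℂ := (8 * (Real.pi : ℂ) ^ 6 / 27) * E6 τ

/-- quasi-period η₁ -/
def eta1 (τ : ℂ) : ℂ := ((Real.pi : ℂ) ^ 2 / 3) * E2 τ

/-- quasi-period η₂ (Legendre relation) -/
def eta2 (τ : ℂ) : ℂ := τ * eta1 τ - 2 * (Real.pi : ℂ) * Complex.I

/-- the function h = g₂² − 18η₁g₃ -/
def hh (τ : ℂ) : ℂ := g2 τ ^ 2 - 18 * eta1 τ * g3 τ

/-- the family f_C -/
def f (C τ : ℂ) : ℂ := (C - τ) * g2 τ ^ 2 - 18 * (C * eta1 τ - eta2 τ) * g3 τ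

end

open scoped UpperHalfPlane MatrixGroups ModularForm

/-- the matrix acting as τ ↦ 1/(1-τ) -/
def gam : SL(2, ℤ) := ⟨!![0, 1; -1, 1], by simp [Matrix.det_fin_two]⟩

theorem gam_smul (z : ℍ) : ((gam • z : ℍ) : ℂ) = 1 / (1 - (z : ℂ)) := by
  rw [UpperHalfPlane.specialLinearGroup_apply]
  simp [gam]
  ring

theorem gam_denom (z : ℍ) : UpperHalfPlane.denom gam z = 1 - (z : ℂ) := by
  rw [ModularGroup.denom_apply]
  simp [gam]
  ring

theorem sigmaC_eq (k n : ℕ) : sigmaC k n = (ArithmeticFunction.sigma k n : ℂ) := by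
  simp [sigmaC, ArithmeticFunction.sigma_apply]

theorem tsum_sigmaC (k : ℕ) (z : ℂ) :
    ∑' n : ℕ, sigmaC k (n + 1) * qq z ^ (n + 1) =
    ∑' n : ℕ+, (ArithmeticFunction.sigma k n : ℂ) * Complex.exp (2 * Real.pi * I * z) ^ (n : ℕ) := by
  rw [tsum_pnat_eq_tsum_succ
    (f := fun n : ℕ => (ArithmeticFunction.sigma k n : ℂ) * Complex.exp (2 * Real.pi * I * z) ^ n)]
  simp [sigmaC_eq, qq]

theorem bern4 : bernoulli 4 = -1 / 30 := by
  rw [bernoulli_eq_bernoulli'_of_ne_one (by decide), bernoulli'_four]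

theorem bern6 : bernoulli 6 = 1 / 42 := by
  rw [bernoulli_eq_bernoulli'_of_ne_one (by decide)]
  have h5 : bernoulli' 5 = 0 := by
    rw [bernoulli'_def]
    norm_num [Finset.sum_range_succ, Nat.choose]
  rw [bernoulli'_def]
  norm_num [Finset.sum_range_succ, Nat.choose, h5]

theorem E2_coe (z : ℍ) : E2 z = EisensteinSeries.E2 z := by
  rw [E2, tsum_sigmaC, EisensteinSeries.E2_eq_tsum_cexp]

theorem E4_coe (z : ℍ) : E4 z = ModularForm.E₄ z := by
  rw [E4, tsum_sigmaC, EisensteinSeries.q_expansion_bernoulli _ (by decide), bern4]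
  norm_num

theorem E6_coe (z : ℍ) : E6 z = ModularForm.E₆ z := by
  rw [E6, tsum_sigmaC, EisensteinSeries.q_expansion_bernoulli _ (by decide), bern6]
  norm_num

theorem MF_trans {k : ℤ} (F : ModularForm 𝒮ℒ k) (z : ℍ) :
    F (gam • z) = (1 - (z : ℂ)) ^ k * F z := by
  rw [← gam_denom]
  exact SlashInvariantForm.slash_action_eqn'' F (Γ := 𝒮ℒ) (γ := (gam : GL (Fin 2) ℝ))
    (MonoidHom.mem_range.mpr ⟨gam, rfl⟩) z

theorem one_sub_ne (z : ℍ) : 1 - (z : ℂ) ≠ 0 := by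
  rw [← gam_denom]; exact UpperHalfPlane.denom_ne_zero _ _

theorem E2_trans (z : ℍ) : EisensteinSeries.E2 (gam • z) =
    (1 - (z : ℂ)) ^ 2 * EisensteinSeries.E2 z + 6 * I / Real.pi * (1 - (z : ℂ)) := by
  have h := congr_fun (EisensteinSeries.E2_slash_action gam) z
  have h0 := one_sub_ne z
  rw [ModularForm.SL_slash_apply] at h
  simp only [gam_denom, Pi.sub_apply, Pi.smul_apply, EisensteinSeries.D2, riemannZeta_two,
    smul_eq_mul] at h
  have h1 : ((gam 1 0 : ℤ) : ℂ) = -1 := by simp [gam]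
  rw [h1] at h
  have hpi : (Real.pi : ℂ) ≠ 0 := by simp [Real.pi_ne_zero]
  rw [zpow_neg] at h
  rw [← div_eq_mul_inv, div_eq_iff (zpow_ne_zero _ h0)] at h
  rw [h]
  norm_cast
  push_cast
  field_simp
  ring

theorem f_C_transformation (C : ℝ) (hC : C ≠ 1) (τ : ℂ) (hτ : 0 < τ.im) :
    f (1 / (1 - (C : ℂ))) (1 / (1 - τ)) = ((1 - τ) ^ 7 / (1 - (C : ℂ))) * f (C : ℂ) τ := by
  obtain ⟨z, rfl⟩ : ∃ z : ℍ, (z : ℂ) = τ := ⟨⟨τ, hτ⟩, rfl⟩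
  have h0 := one_sub_ne z
  have hC' : 1 - (C : ℂ) ≠ 0 := by
    rw [sub_ne_zero]; exact_mod_cast hC.symm
  have hpi : (Real.pi : ℂ) ≠ 0 := by simp [Real.pi_ne_zero]
  have e4 : E4 (1 / (1 - (z : ℂ))) = (1 - (z : ℂ)) ^ 4 * E4 z := by
    rw [← gam_smul, E4_coe, E4_coe, MF_trans]; norm_cast
  have e6 : E6 (1 / (1 - (z : ℂ))) = (1 - (z : ℂ)) ^ 6 * E6 z := by
    rw [← gam_smul, E6_coe, E6_coe, MF_trans]; norm_cast
  have e2 : E2 (1 / (1 - (z : ℂ))) =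
      (1 - (z : ℂ)) ^ 2 * E2 z + 6 * I / Real.pi * (1 - (z : ℂ)) := by
    rw [← gam_smul, E2_coe, E2_coe, E2_trans]
  have a1 : eta1 (1 / (1 - (z : ℂ))) = (1 - (z : ℂ)) * (eta1 z - eta2 z) := by
    simp only [eta2, eta1, e2]
    field_simp
    ring
  have a2 : eta2 (1 / (1 - (z : ℂ))) = (1 - (z : ℂ)) * eta1 z := by
    rw [eta2, a1, eta2]
    field_simp
    ring
  have b2 : g2 (1 / (1 - (z : ℂ))) = (1 - (z : ℂ)) ^ 4 * g2 z := by
    rw [g2, e4, g2]; ring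
  have b3 : g3 (1 / (1 - (z : ℂ))) = (1 - (z : ℂ)) ^ 6 * g3 z := by
    rw [g3, e6, g3]; ring
  rw [f, a1, a2, b2, b3, f]
  field_simp
  ring
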